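/- Let K be a compact subset of ℂ. Then ℂ \ K is connected if and only if every function that is continuous on K and holomorphic on the interior of K is a uniform limit on K of Dirichlet polynomials (i.e. D(K) = A(K)). -/

import Mathlib

open Complex Set

/-- A Dirichlet polynomial: a function of the form `z ↦ ∑_{k=1}^m a_k k^{-z}`. -/
def IsDirichletPolynomial (f : ℂ → ℂ) : Prop :=
  ∃ (m : ℕ) (a : ℕ → ℂ), ∀ z : ℂ, f z = ∑ k ∈ Finset.Icc 1 m, a k * (k : ℂ) ^ (-z)

open MeasureTheory

/-- `f` is a uniform limit of polynomials on `K`. -/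
def PolyApprox (K : Set ℂ) (f : ℂ → ℂ) : Prop :=
  ∀ ε > 0, ∃ p : Polynomial ℂ, ∀ z ∈ K, ‖f z - p.eval z‖ < ε

namespace PolyApprox

variable {K : Set ℂ} {f g : ℂ → ℂ}

lemma polynomial (p : Polynomial ℂ) : PolyApprox K (fun z => p.eval z) :=
  fun ε hε => ⟨p, fun z _ => by simpa using hε⟩

lemma const (c : ℂ) : PolyApprox K (fun _ => c) := by
  simpa using polynomial (K := K) (Polynomial.C c)

lemma id : PolyApprox K (fun z => z) := by
  simpa using polynomial (K := K) Polynomial.X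

lemma of_approx (h : ∀ ε > 0, ∃ g, PolyApprox K g ∧ ∀ z ∈ K, ‖f z - g z‖ < ε) :
    PolyApprox K f := by
  intro ε hε
  obtain ⟨g, hg, hfg⟩ := h (ε / 2) (by positivity)
  obtain ⟨p, hp⟩ := hg (ε / 2) (by positivity)
  refine ⟨p, fun z hz => ?_⟩
  calc ‖f z - p.eval z‖ ≤ ‖f z - g z‖ + ‖g z - p.eval z‖ := norm_sub_le_norm_sub_add_norm_sub ..
    _ < ε := by linarith [hfg z hz, hp z hz]

lemma congr (hf : PolyApprox K f) (h : ∀ z ∈ K, g z = f z) : PolyApprox K g :=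
  of_approx fun ε hε => ⟨f, hf, fun z hz => by simpa [h z hz] using hε⟩

lemma add (hf : PolyApprox K f) (hg : PolyApprox K g) : PolyApprox K (fun z => f z + g z) := by
  intro ε hε
  obtain ⟨p, hp⟩ := hf (ε / 2) (by positivity)
  obtain ⟨q, hq⟩ := hg (ε / 2) (by positivity)
  refine ⟨p + q, fun z hz => ?_⟩
  rw [Polynomial.eval_add, add_sub_add_comm]
  exact (norm_add_le _ _).trans_lt (by linarith [hp z hz, hq z hz])

lemma exists_bound (hK : IsCompact K) (hf : PolyApprox K f) : ∃ M > 0, ∀ z ∈ K, ‖f z‖ ≤ M := by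
  obtain ⟨p, hp⟩ := hf 1 one_pos
  obtain ⟨M, hM⟩ := hK.exists_bound_of_continuousOn (p.continuous.continuousOn (s := K))
  refine ⟨1 + |M|, by positivity, fun z hz => ?_⟩
  have := norm_le_norm_sub_add (f z) (p.eval z)
  linarith [hp z hz, hM z hz, le_abs_self M]

lemma mul (hK : IsCompact K) (hf : PolyApprox K f) (hg : PolyApprox K g) :
    PolyApprox K (fun z => f z * g z) := by
  intro ε hε
  obtain ⟨M, hM, hgM⟩ := hg.exists_bound hK
  obtain ⟨p, hp⟩ := hf (ε / 2 / M) (by positivity)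
  obtain ⟨N, hN, hpN⟩ := (polynomial (K := K) p).exists_bound hK
  obtain ⟨q, hq⟩ := hg (ε / 2 / N) (by positivity)
  refine ⟨p * q, fun z hz => ?_⟩
  have h1 : f z * g z - (p * q).eval z
      = (f z - p.eval z) * g z + p.eval z * (g z - q.eval z) := by
    rw [Polynomial.eval_mul]; ring
  rw [h1]
  have h2 : ‖f z - p.eval z‖ * ‖g z‖ ≤ ε / 2 / M * M :=
    mul_le_mul (hp z hz).le (hgM z hz) (norm_nonneg _) (by positivity)
  have h3 : ‖p.eval z‖ * ‖g z - q.eval z‖ < N * (ε / 2 / N) :=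
    mul_lt_mul_of_le_of_lt_of_nonneg_of_pos (hpN z hz) (hq z hz) (norm_nonneg _) hN
  rw [div_mul_cancel₀ _ hM.ne'] at h2
  rw [mul_div_cancel₀ _ hN.ne'] at h3
  refine (norm_add_le _ _).trans_lt ?_
  rw [norm_mul, norm_mul]
  linarith

lemma const_mul (hK : IsCompact K) (c : ℂ) (hf : PolyApprox K f) :
    PolyApprox K (fun z => c * f z) := (const c).mul hK hf

lemma sub (hK : IsCompact K) (hf : PolyApprox K f) (hg : PolyApprox K g) :
    PolyApprox K (fun z => f z - g z) :=
  (hf.add (hg.const_mul hK (-1))).congr fun z _ => by ring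

lemma pow (hK : IsCompact K) (hf : PolyApprox K f) (n : ℕ) : PolyApprox K (fun z => f z ^ n) := by
  induction n with
  | zero => simpa using const (K := K) 1
  | succ n ih => simpa [pow_succ] using ih.mul hK hf

lemma sum {ι : Type*} (s : Finset ι) {F : ι → ℂ → ℂ} (hF : ∀ i, PolyApprox K (F i)) :
    PolyApprox K (fun z => ∑ i ∈ s, F i z) := by
  classical
  induction s using Finset.induction_on with
  | empty => simpa using const (K := K) 0
  | insert i s hi ih => simpa [Finset.sum_insert hi] using (hF i).add ih

lemma comp_differentiableOn_ball (hK : IsCompact K) (hfc : ContinuousOn f K)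
    (hf : PolyApprox K f) (hf1 : ∀ z ∈ K, ‖f z‖ < 1) {φ : ℂ → ℂ}
    (hφ : DifferentiableOn ℂ φ (Metric.ball 0 1)) : PolyApprox K (fun z => φ (f z)) := by
  obtain ⟨r, hr1, hr⟩ := exists_lt_subset_ball (hK.image_of_continuousOn hfc).isClosed
    (show f '' K ⊆ Metric.ball 0 1 by rintro _ ⟨z, hz, rfl⟩; simpa using hf1 z hz)
  obtain ⟨R, hR, hR1⟩ := exists_between (max_lt hr1 one_pos)
  lift R to NNReal using ((le_max_right _ _).trans_lt hR).le
  obtain ⟨S, hS, hSR⟩ := exists_between hR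
  lift S to NNReal using ((le_max_right _ _).trans_lt hS).le
  have hps := (hφ.mono (Metric.closedBall_subset_ball hR1)).hasFPowerSeriesOnBall
    (by exact_mod_cast (le_max_right _ _).trans_lt hR)
  have hunif := hps.tendstoUniformlyOn (r' := S) (by exact_mod_cast hSR)
  rw [Metric.tendstoUniformlyOn_iff] at hunif
  refine of_approx fun ε hε => ?_
  obtain ⟨n, hn⟩ := (hunif ε hε).exists
  refine ⟨fun z => (cauchyPowerSeries φ 0 R).partialSum n (f z), ?_, fun z hz => ?_⟩
  · simp only [FormalMultilinearSeries.partialSum]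
    refine sum _ fun i => ?_
    refine ((hf.pow hK i).mul hK (const ((cauchyPowerSeries φ 0 R).coeff i))).congr fun z _ => ?_
    simp
  · have hz' : f z ∈ Metric.ball 0 S :=
      Metric.ball_subset_ball ((le_max_left _ _).trans hS.le) (hr ⟨z, hz, rfl⟩)
    simpa [dist_eq_norm] using hn _ hz'

end PolyApprox

/-- `p` and `q` are closer to each other than to any point of `K`, and at distance less than one. -/
def CloseOff (K : Set ℂ) (p q : ℂ) : Prop :=
  ‖p - q‖ < 1 ∧ ∀ z ∈ K, ‖p - q‖ < ‖z - p‖ ∧ ‖p - q‖ < ‖z - q‖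

lemma reflTransGen_closeOff {K : Set ℂ} (hK : IsCompact K) (hc : IsPreconnected Kᶜ) {a b : ℂ}
    (ha : a ∈ Kᶜ) (hb : b ∈ Kᶜ) : Relation.ReflTransGen (CloseOff K) a b := by
  have hsymm : Std.Symm (CloseOff K) := ⟨fun p q h => by
    refine ⟨by rw [norm_sub_rev]; exact h.1, fun z hz => ?_⟩
    rw [norm_sub_rev q p]
    exact (h.2 z hz).symm⟩
  refine hc.induction₂ (Relation.ReflTransGen (CloseOff K)) (fun x hx => ?_)
    (fun x y z _ _ _ h1 h2 => h1.trans h2) (fun x y _ _ h => symm h) ha hb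
  obtain ⟨r, hr, hball⟩ := Metric.isOpen_iff.mp hK.isClosed.isOpen_compl x hx
  filter_upwards [nhdsWithin_le_nhds (Metric.ball_mem_nhds x (ε := min (r / 2) 1) (by positivity))]
    with y hy
  rw [mem_ball_iff_norm', lt_min_iff] at hy
  refine Relation.ReflTransGen.single ⟨hy.2, fun z hz => ?_⟩
  have h1 : r ≤ ‖z - x‖ := by
    by_contra! h
    exact hball (mem_ball_iff_norm.mpr h) hz
  have h2 := norm_sub_le_norm_sub_add_norm_sub z y x
  rw [norm_sub_rev y x] at h2
  constructor <;> linarith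

lemma PolyApprox.inv_sub {K : Set ℂ} (hK : IsCompact K) (hc : IsPreconnected Kᶜ) {a : ℂ}
    (ha : a ∈ Kᶜ) : PolyApprox K (fun z => (z - a)⁻¹) := by
  have hφ : DifferentiableOn ℂ (fun x : ℂ => (1 - x)⁻¹) (Metric.ball 0 1) := by
    intro x hx
    have : 1 - x ≠ 0 := by
      intro h
      rw [← sub_eq_zero.mp h] at hx
      simp at hx
    exact ((differentiableAt_const _).sub differentiableAt_id).inv this |>.differentiableWithinAt
  obtain ⟨R, hR0, hR⟩ := hK.isBounded.exists_pos_norm_lt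
  have hne : (R : ℂ) ≠ 0 := by exact_mod_cast hR0.ne'
  have hRK : (R : ℂ) ∈ Kᶜ := fun h => by simpa [abs_of_pos hR0] using hR _ h
  have hchain := reflTransGen_closeOff hK hc hRK ha
  induction hchain with
  | refl =>
    have h := (PolyApprox.comp_differentiableOn_ball hK (f := fun z => (R : ℂ)⁻¹ * z)
      (by fun_prop) (PolyApprox.id.const_mul hK _) (fun z hz => ?_) hφ).const_mul hK (-(R : ℂ)⁻¹)
    · refine h.congr fun z hz => ?_
      rw [neg_mul, ← mul_inv, neg_inv]
      congr 1
      field_simp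
      ring
    · rw [norm_mul, norm_inv, norm_real, Real.norm_of_nonneg hR0.le, inv_mul_lt_iff₀ hR0]
      simpa using hR z hz
  | @tail p q hp hpq ih =>
    have hpK : p ∈ Kᶜ := fun h => by
      have := (hpq.2 p h).1
      rw [sub_self, norm_zero] at this
      exact absurd this (norm_nonneg _).not_gt
    have hne : ∀ z ∈ K, z - p ≠ 0 := fun z hz => sub_ne_zero.mpr fun h => hpK (h ▸ hz)
    have ih := ih hpK
    have h := ih.mul hK (PolyApprox.comp_differentiableOn_ball hK
      (f := fun z => (q - p) * (z - p)⁻¹)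
      (continuousOn_const.mul ((continuousOn_id.sub continuousOn_const).inv₀ hne))
      (ih.const_mul hK _) (fun z hz => ?_) hφ)
    · refine h.congr fun z hz => ?_
      have := hne z hz
      rw [← mul_inv]
      congr 1
      field_simp
      ring
    · rw [norm_mul, norm_inv, mul_inv_lt_iff₀ (norm_pos_iff.mpr (hne z hz)), norm_sub_rev, one_mul]
      exact (hpq.2 z hz).1

lemma sqrt_div {a b : ℂ} (ha : 0 < a.re) (hb : 0 < b.re) :
    (a / b) ^ (1 / 2 : ℂ) = a ^ (1 / 2 : ℂ) / b ^ (1 / 2 : ℂ) := by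
  have ha0 : a ≠ 0 := fun h => by simp [h] at ha
  have hb0 : b ≠ 0 := fun h => by simp [h] at hb
  have h1 := abs_lt.mp (abs_arg_lt_pi_div_two_iff.mpr (Or.inl ha))
  have h2 := abs_lt.mp (abs_arg_lt_pi_div_two_iff.mpr (Or.inl hb))
  have hlog : log (a / b) = log a - log b := by
    rw [← exp_log ha0, ← exp_log hb0, ← exp_sub, log_exp, exp_log ha0, exp_log hb0]
    all_goals simp only [sub_im, log_im]; linarith
  rw [cpow_def_of_ne_zero (div_ne_zero ha0 hb0), cpow_def_of_ne_zero ha0,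
    cpow_def_of_ne_zero hb0, hlog, sub_mul, exp_sub]

/-- `s` is a branch of the square root of `(z - c) / (z - d)` on `K`, principal near infinity,
which is a uniform limit of polynomials on `K`. -/
structure SqrtBranch (K : Set ℂ) (c d : ℂ) (s : ℂ → ℂ) : Prop where
  approx : PolyApprox K s
  sq : ∀ z ∈ K, s z ^ 2 = (z - c) / (z - d)
  far : ∀ z ∈ K, 2 < ‖z - c‖ → s z * (1 - (d - c) / (z - c)) ^ (1 / 2 : ℂ) = 1

lemma SqrtBranch.refl {K : Set ℂ} {c : ℂ} (hc : c ∉ K) : SqrtBranch K c c (fun _ => 1) where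
  approx := PolyApprox.const 1
  sq z hz := by 
    have h : z - c ≠ 0 := sub_ne_zero.mpr fun h => hc (h ▸ hz)
    rw [div_self h, one_pow]
  far z hz _ := by simp

lemma re_one_sub_div_pos {u v : ℂ} (hu : ‖u‖ ≤ 2) (hv : 2 < ‖v‖) : 0 < (1 - u / v).re := by
  have h1 : ‖u / v‖ < 1 := by
    rw [norm_div, div_lt_one (by linarith)]; linarith
  have := (abs_le.mp (abs_re_le_norm (u / v))).2
  simp only [sub_re, one_re]
  linarith

lemma SqrtBranch.step {K : Set ℂ} (hK : IsCompact K) (hconn : IsPreconnected Kᶜ) {c p q : ℂ}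
    {s : ℂ → ℂ} (hs : SqrtBranch K c p s) (hp : p ∉ K) (hq : q ∉ K) (hpq : CloseOff K p q)
    (hpc : ‖p - c‖ ≤ 2) (hqc : ‖q - c‖ ≤ 2) :
    SqrtBranch K c q (fun z => s z * ((z - p) / (z - q)) ^ (1 / 2 : ℂ)) := by
  have hne : ∀ z ∈ K, ∀ a ∉ K, z - a ≠ 0 := fun z hz a ha => sub_ne_zero.mpr fun h => ha (h ▸ hz)
  refine ⟨hs.approx.mul hK ?_, fun z hz => ?_, fun z hz hzc => ?_⟩
  · have hφ : DifferentiableOn ℂ (fun x : ℂ => (1 + x) ^ (1 / 2 : ℂ)) (Metric.ball 0 1) := by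
      intro x hx
      refine DifferentiableAt.differentiableWithinAt ?_
      refine ((differentiableAt_const _).add differentiableAt_id).cpow_const (Or.inl ?_)
      have := (abs_le.mp (abs_re_le_norm x)).1
      rw [mem_ball_zero_iff] at hx
      change 0 < (1 + x).re
      rw [add_re, one_re]
      linarith
    refine (PolyApprox.comp_differentiableOn_ball hK (f := fun z => (q - p) * (z - q)⁻¹)
      (continuousOn_const.mul ((continuousOn_id.sub continuousOn_const).inv₀
        fun z hz => hne z hz q hq))
      ((PolyApprox.inv_sub hK hconn hq).const_mul hK _) (fun z hz => ?_) hφ).congr fun z hz => ?_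
    · rw [norm_mul, norm_inv, mul_inv_lt_iff₀ (norm_pos_iff.mpr (hne z hz q hq)), norm_sub_rev,
        one_mul]
      exact (hpq.2 z hz).2
    · have := hne z hz q hq
      congr 1
      field_simp
      ring
  · have h1 := hne z hz p hp
    have h2 := hne z hz q hq
    rw [mul_pow, hs.sq z hz, ← cpow_nat_mul]
    norm_num
    field_simp
  · have hzc0 : z - c ≠ 0 := norm_pos_iff.mp (by linarith)
    have hP := re_one_sub_div_pos hpc hzc
    have hQ := re_one_sub_div_pos hqc hzc
    have h1 : (z - p) / (z - q) = (1 - (p - c) / (z - c)) / (1 - (q - c) / (z - c)) := by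
      have h2 := hne z hz q hq
      have e1 : 1 - (p - c) / (z - c) = (z - p) / (z - c) := by field_simp; ring
      have e2 : 1 - (q - c) / (z - c) = (z - q) / (z - c) := by field_simp; ring
      rw [e1, e2]
      field_simp
    have hQ0 : (1 - (q - c) / (z - c)) ^ (1 / 2 : ℂ) ≠ 0 := by
      rw [Ne, cpow_eq_zero_iff]
      rintro ⟨h, -⟩
      rw [h] at hQ
      simp at hQ
    rw [h1, sqrt_div hP hQ, mul_assoc, div_mul_cancel₀ _ hQ0]
    exact hs.far z hz hzc

lemma exists_sqrtBranch {K : Set ℂ} (hK : IsCompact K) (hconn : IsPreconnected Kᶜ) {c : ℂ}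
    (hc : c ∉ K) : ∃ d s, d ∉ K ∧ 1 ≤ ‖d - c‖ ∧ ‖d - c‖ ≤ 2 ∧ SqrtBranch K c d s := by
  obtain ⟨R, hR0, hR⟩ :=
    (hK.isBounded.union (Metric.isBounded_ball (x := c) (r := 1))).exists_pos_norm_lt
  have hRK : (R : ℂ) ∉ K ∪ Metric.ball c 1 := fun h => by
    simpa [abs_of_pos hR0] using hR _ h
  have key : ∀ q, Relation.ReflTransGen (CloseOff K) c q →
      (∃ d s, d ∉ K ∧ 1 ≤ ‖d - c‖ ∧ ‖d - c‖ ≤ 2 ∧ SqrtBranch K c d s) ∨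
      (q ∉ K ∧ ‖q - c‖ < 1 ∧ ∃ s, SqrtBranch K c q s) := by
    intro q hq
    induction hq with
    | refl => exact Or.inr ⟨hc, by simp, _, SqrtBranch.refl hc⟩
    | @tail p q _ hpq ih =>
      rcases ih with h | ⟨hp, hpc, s, hs⟩
      · exact Or.inl h
      have hqK : q ∉ K := fun h => by
        have := (hpq.2 q h).2
        rw [sub_self, norm_zero] at this
        exact absurd this (norm_nonneg _).not_gt
      have hqc : ‖q - c‖ ≤ 2 := by
        have := norm_sub_le_norm_sub_add_norm_sub q p c
        rw [norm_sub_rev q p] at this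
        linarith [hpq.1]
      have hs' := hs.step hK hconn hp hqK hpq (by linarith) hqc
      rcases lt_or_ge ‖q - c‖ 1 with h | h
      · exact Or.inr ⟨hqK, h, _, hs'⟩
      · exact Or.inl ⟨q, _, hqK, h, hqc, hs'⟩
  rcases key R (reflTransGen_closeOff hK hconn hc fun h => hRK (Or.inl h)) with h | ⟨-, h, -⟩
  · exact h
  · exact absurd (Or.inr (mem_ball_iff_norm.mpr h)) hRK

/-- An integrable majorant for the error in replacing the Cauchy kernel. -/
noncomputable def cauchyMajorant (u : ℂ) : ℝ := (‖u‖ * (1 + ‖u‖) ^ 2)⁻¹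

lemma norm_inv_sub_sub_le_far {y w g : ℂ} (hy : 29 ≤ ‖y‖) (hw : ‖w‖ ≤ 3)
    (hg : ‖g‖ ≤ 4 / ‖y‖) (hgy : ‖g - y⁻¹‖ ≤ 4 / ‖y‖ ^ 3) :
    ‖(y - w)⁻¹ - (g + w * g ^ 2)‖ ≤ 240 * cauchyMajorant (y - w) := by
  have hy0 : y ≠ 0 := norm_pos_iff.mp (by linarith)
  set N := ‖y‖ with hN
  have hN0 : 0 < N := by linarith
  have hlow : N - 3 ≤ ‖y - w‖ := by linarith [norm_sub_norm_le y w]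
  have hup : ‖y - w‖ ≤ N + 3 := by linarith [norm_sub_le y w]
  have hyw : y - w ≠ 0 := norm_pos_iff.mp (by linarith)
  have hdec : (y - w)⁻¹ - (g + w * g ^ 2)
      = w ^ 2 / (y ^ 2 * (y - w)) - (g - y⁻¹) - w * ((g - y⁻¹) * (g + y⁻¹)) := by
    field_simp
    ring
  have h1 : ‖w ^ 2 / (y ^ 2 * (y - w))‖ ≤ 18 / N ^ 3 := by
    rw [norm_div, norm_mul, norm_pow, norm_pow, ← hN,
      div_le_div_iff₀ (by positivity) (by positivity)]
    have : ‖w‖ ^ 2 ≤ 9 := by nlinarith [norm_nonneg w]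
    have h2 : N ≤ 2 * ‖y - w‖ := by linarith
    nlinarith [mul_le_mul this h2 hN0.le (by norm_num), pow_pos hN0 2]
  have h2 : ‖g + y⁻¹‖ ≤ 5 / N := by
    refine (norm_add_le _ _).trans ?_
    rw [norm_inv, ← hN]
    calc ‖g‖ + N⁻¹ ≤ 4 / N + N⁻¹ := by linarith
      _ = 5 / N := by field_simp; norm_num
  have h3 : ‖w * ((g - y⁻¹) * (g + y⁻¹))‖ ≤ 8 / N ^ 3 := by
    rw [norm_mul, norm_mul]
    calc ‖w‖ * (‖g - y⁻¹‖ * ‖g + y⁻¹‖) ≤ 3 * (4 / N ^ 3 * (5 / N)) := by gcongr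
      _ = 60 / N / N ^ 3 := by field_simp; norm_num
      _ ≤ 8 / N ^ 3 := by
        gcongr
        rw [div_le_iff₀ hN0]; linarith
  have h4 : ‖(y - w)⁻¹ - (g + w * g ^ 2)‖ ≤ 30 / N ^ 3 := by
    rw [hdec]
    refine (norm_sub_le _ _).trans ?_
    have := norm_sub_le (w ^ 2 / (y ^ 2 * (y - w))) (g - y⁻¹)
    calc _ ≤ 18 / N ^ 3 + 4 / N ^ 3 + 8 / N ^ 3 := by linarith
      _ = 30 / N ^ 3 := by ring
  refine h4.trans ?_
  rw [cauchyMajorant, ← div_eq_mul_inv, div_le_div_iff₀ (by positivity) (by positivity)]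
  have h5 : ‖y - w‖ * (1 + ‖y - w‖) ^ 2 ≤ (2 * N) * (2 * N) ^ 2 := by
    gcongr <;> linarith
  linarith [h5, show (2 * N) * (2 * N) ^ 2 = 8 * N ^ 3 by ring]

lemma SqrtBranch.norm_error_le {K : Set ℂ} {c d : ℂ} {s : ℂ → ℂ} (hs : SqrtBranch K c d s)
    (hd : d ∉ K) (h1 : 1 ≤ ‖d - c‖) (h2 : ‖d - c‖ ≤ 2) {z ζ : ℂ} (hz : z ∈ K)
    (hζ : ‖ζ - c‖ < 2) (hne : z ≠ ζ) {g : ℂ}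
    (hg : g = 8 / (d - c) ^ 2 * (z - (c + d) / 2 - (z - d) * s z)) :
    ‖(z - ζ)⁻¹ - (g + (ζ - (c + d) / 2) * g ^ 2)‖ ≤ 10 ^ 11 * cauchyMajorant (z - ζ) := by
  set y := z - (c + d) / 2 with hy
  set w := ζ - (c + d) / 2 with hw
  set S := (z - d) * s z with hS
  set D := d - c with hD
  have hD0 : D ≠ 0 := norm_pos_iff.mp (by linarith)
  have hzd : z - d ≠ 0 := sub_ne_zero.mpr fun h => hd (h ▸ hz)
  have hS2 : S ^ 2 = (z - d) * (z - c) := by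
    rw [hS, mul_pow, hs.sq z hz]; field_simp
  have hyS : y ^ 2 - S ^ 2 = D ^ 2 / 4 := by rw [hS2, hy, hD]; ring
  have hhalf : ‖D / 2‖ ≤ 1 := by rw [norm_div]; norm_num; linarith
  have hyc : y = (z - c) - D / 2 := by rw [hy, hD]; ring
  have hw3 : ‖w‖ ≤ 3 := by
    have : w = (ζ - c) - D / 2 := by rw [hw, hD]; ring
    rw [this]
    linarith [norm_sub_le (ζ - c) (D / 2)]
  have hu : z - ζ = y - w := by rw [hy, hw]; ring
  rw [hu]
  have hu0 : 0 < ‖y - w‖ := by rw [← hu]; exact norm_pos_iff.mpr (sub_ne_zero.mpr hne)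
  have hmaj : 0 ≤ cauchyMajorant (y - w) := by unfold cauchyMajorant; positivity
  rcases le_or_gt ‖z - c‖ 30 with hnear | hfar
  · have hy31 : ‖y‖ ≤ 31 := by rw [hyc]; linarith [norm_sub_le (z - c) (D / 2)]
    have hzd32 : ‖z - d‖ ≤ 32 := by
      have : z - d = (z - c) - D := by rw [hD]; ring
      rw [this]; linarith [norm_sub_le (z - c) D]
    have hS31 : ‖S‖ ≤ 31 := by
      have : ‖S‖ ^ 2 ≤ 32 * 30 := by
        rw [← norm_pow, hS2, norm_mul]; gcongr
      nlinarith [norm_nonneg S]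
    have hgn : ‖g‖ ≤ 496 := by
      rw [hg, norm_mul, norm_div, norm_pow]
      have h3 : ‖y - S‖ ≤ 62 := by linarith [norm_sub_le y S]
      have h4 : ‖(8 : ℂ)‖ / ‖D‖ ^ 2 ≤ 8 := by
        rw [div_le_iff₀ (by positivity)]
        norm_num
        nlinarith
      calc _ ≤ (8 : ℝ) * 62 := by gcongr
        _ = 496 := by norm_num
    have hQ : ‖g + w * g ^ 2‖ ≤ 10 ^ 6 := by
      refine (norm_add_le _ _).trans ?_
      rw [norm_mul, norm_pow]
      calc _ ≤ (496 : ℝ) + 3 * 496 ^ 2 := by gcongr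
        _ ≤ 10 ^ 6 := by norm_num
    have hu34 : ‖y - w‖ ≤ 34 := by linarith [norm_sub_le y w]
    refine (norm_sub_le _ _).trans ?_
    rw [norm_inv, cauchyMajorant, mul_inv, ← div_eq_mul_inv,
      ← mul_div_assoc, le_div_iff₀ (by positivity)]
    set U := ‖y - w‖
    have h5 : (1 + U) ^ 2 ≤ 35 ^ 2 := by gcongr; linarith
    calc (U⁻¹ + ‖g + w * g ^ 2‖) * (1 + U) ^ 2 ≤ (U⁻¹ + 10 ^ 6) * 35 ^ 2 := by gcongr
      _ = U⁻¹ * ((1 + 10 ^ 6 * U) * 35 ^ 2) := by field_simp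
      _ ≤ U⁻¹ * ((1 + 10 ^ 6 * 34) * 35 ^ 2) := by gcongr
      _ ≤ U⁻¹ * 10 ^ 11 := by gcongr; norm_num
      _ = 10 ^ 11 * U⁻¹ := mul_comm _ _
  · have hzc0 : z - c ≠ 0 := norm_pos_iff.mp (by linarith)
    have hN29 : 29 ≤ ‖y‖ := by rw [hyc]; linarith [norm_sub_norm_le (z - c) (D / 2)]
    have hy0 : y ≠ 0 := norm_pos_iff.mp (by linarith)
    set t := D / (z - c) with ht
    set σ := (1 - t) ^ (1 / 2 : ℂ) with hσ
    have hsσ : s z * σ = 1 := hs.far z hz (by linarith)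
    have hσ2 : σ ^ 2 = 1 - t := by rw [hσ, ← cpow_nat_mul]; norm_num
    have hSσ : S = (z - c) * σ := by
      have : z - d = (z - c) * σ ^ 2 := by rw [hσ2, ht, hD]; field_simp; ring
      rw [hS, this]; linear_combination (z - c) * σ * hsσ
    have hσre : 0 ≤ σ.re := by
      have h1t : 1 - t ≠ 0 := fun h => by
        have := re_one_sub_div_pos (u := D) (v := z - c) h2 (by linarith)
        rw [← ht, h] at this
        simp at this
      rw [hσ, cpow_def_of_ne_zero h1t, exp_re]
      refine mul_nonneg (Real.exp_pos _).le (Real.cos_nonneg_of_mem_Icc ?_)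
      have : (log (1 - t) * (1 / 2 : ℂ)).im = arg (1 - t) / 2 := by
        rw [show (1 / 2 : ℂ) = ((1 / 2 : ℝ) : ℂ) by norm_num, im_mul_ofReal, log_im]; ring
      rw [this]
      constructor <;> linarith [neg_pi_lt_arg (1 - t), arg_le_pi (1 - t)]
    have htn : ‖t / 2‖ ≤ 1 / 30 := by
      rw [ht, div_right_comm, norm_div, div_le_iff₀ (by linarith)]; linarith
    have hsum : ‖y‖ / 2 ≤ ‖y + S‖ := by
      have e1 : y + S = (z - c) * (1 - t / 2 + σ) := by
        rw [hSσ, hyc, ht]; field_simp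
      have e2 : 29 / 30 ≤ ‖1 - t / 2 + σ‖ := by
        refine le_trans ?_ (re_le_norm _)
        have := (abs_le.mp (abs_re_le_norm (t / 2))).2
        simp only [add_re, sub_re, one_re]
        linarith
      have e3 : ‖y‖ ≤ ‖z - c‖ + 1 := by rw [hyc]; linarith [norm_sub_le (z - c) (D / 2)]
      rw [e1, norm_mul]
      nlinarith
    have hyS0 : y + S ≠ 0 := norm_pos_iff.mp (by linarith)
    have hgy : g = 2 / (y + S) := by
      rw [hg]
      field_simp
      linear_combination 8 * hyS
    have hgn : ‖g‖ ≤ 4 / ‖y‖ := by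
      rw [hgy, norm_div, div_le_div_iff₀ (by linarith) (by linarith)]
      norm_num
      linarith
    have hgi : ‖g - y⁻¹‖ ≤ 4 / ‖y‖ ^ 3 := by
      have e1 : g - y⁻¹ = y⁻¹ * (D / 2) ^ 2 * (g / 2) ^ 2 := by
        rw [hgy]
        field_simp
        linear_combination 4 * hyS
      have e2 : ‖g / 2‖ ≤ 2 / ‖y‖ := by
        rw [norm_div, norm_ofNat, div_le_iff₀ two_pos]
        exact hgn.trans_eq (by ring)
      rw [e1, norm_mul, norm_mul, norm_pow, norm_pow, norm_inv]
      calc _ ≤ ‖y‖⁻¹ * 1 ^ 2 * (2 / ‖y‖) ^ 2 := by gcongr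
        _ = 4 / ‖y‖ ^ 3 := by field_simp; norm_num
    refine (norm_inv_sub_sub_le_far hN29 hw3 hgn hgi).trans ?_
    gcongr
    norm_num

/-- Off a compact set with connected complement, the Cauchy kernel with pole near a point of the
complement is approximated by a quadratic expression in a limit of polynomials. -/
lemma exists_polyApprox_kernel {K : Set ℂ} (hK : IsCompact K) (hconn : IsPreconnected Kᶜ) {c : ℂ}
    (hc : c ∉ K) : ∃ (g : ℂ → ℂ) (m : ℂ), PolyApprox K g ∧
      ∀ z ∈ K, ∀ ζ ∈ Metric.ball c 2, z ≠ ζ →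
        ‖(z - ζ)⁻¹ - (g z + (ζ - m) * g z ^ 2)‖ ≤ 10 ^ 11 * cauchyMajorant (z - ζ) := by
  obtain ⟨d, s, hd, h1, h2, hs⟩ := exists_sqrtBranch hK hconn hc
  refine ⟨fun z => 8 / (d - c) ^ 2 * (z - (c + d) / 2 - (z - d) * s z), (c + d) / 2, ?_,
    fun z hz ζ hζ hne => hs.norm_error_le hd h1 h2 hz (mem_ball_iff_norm.mp hζ) hne rfl⟩
  exact ((PolyApprox.id.sub hK (.const _)).sub hK
    ((PolyApprox.id.sub hK (.const _)).mul hK hs.approx)).const_mul hK _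

lemma cauchyMajorant_nonneg (u : ℂ) : 0 ≤ cauchyMajorant u := by
  unfold cauchyMajorant; positivity

lemma integrable_cauchyMajorant : Integrable cauchyMajorant := by
  refine (integrable_fun_norm_addHaar volume (f := fun ρ : ℝ => (ρ * (1 + ρ) ^ 2)⁻¹)).mpr ?_
  refine (integrableOn_add_rpow_Ioi_of_lt (a := -2) (c := 0) (m := 1)
    (by norm_num) (by norm_num)).congr_fun (fun ρ hρ => ?_) measurableSet_Ioi
  have hρ : 0 < ρ := hρ
  have h1 : 0 < ρ + 1 := by linarith
  simp only [finrank_real_complex, smul_eq_mul]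
  rw [Real.rpow_neg h1.le, Real.rpow_two]
  field_simp
  ring

lemma integrable_cauchyMajorant_sub (z : ℂ) : Integrable fun ζ => cauchyMajorant (z - ζ) :=
  integrable_cauchyMajorant.comp_sub_left z

lemma integral_cauchyMajorant_sub (z : ℂ) :
    ∫ ζ, cauchyMajorant (z - ζ) = ∫ u, cauchyMajorant u :=
  integral_sub_left_eq_self _ _ z

/-- Essentially: bounded measurable functions with bounded support. -/
structure BoundedData (h : ℂ → ℂ) : Prop where
  measurable : Measurable h
  bound : ∃ B, ∀ ζ, ‖h ζ‖ ≤ B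
  support : ∃ R, ∀ ζ, R ≤ ‖ζ‖ → h ζ = 0

namespace BoundedData

variable {h : ℂ → ℂ}

lemma indicator (hh : BoundedData h) {s : Set ℂ} (hs : MeasurableSet s) :
    BoundedData (s.indicator h) := by
  obtain ⟨hm, ⟨B, hB⟩, R, hR⟩ := hh
  refine ⟨hm.indicator hs, ⟨B, fun ζ => (norm_indicator_le_norm_self h ζ).trans (hB ζ)⟩,
    R, fun ζ hζ => ?_⟩
  rw [indicator_apply_eq_zero]
  exact fun _ => hR ζ hζ

lemma mul_continuous (hh : BoundedData h) {φ : ℂ → ℂ} (hφ : Continuous φ) :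
    BoundedData (fun ζ => h ζ * φ ζ) := by
  obtain ⟨hm, ⟨B, hB⟩, R, hR⟩ := hh
  obtain ⟨C, hC⟩ := (isCompact_closedBall (0 : ℂ) R).exists_bound_of_continuousOn hφ.continuousOn
  refine ⟨hm.mul hφ.measurable, ⟨B * |C|, fun ζ => ?_⟩, R, fun ζ hζ => by simp [hR ζ hζ]⟩
  have hB0 : 0 ≤ B := (norm_nonneg _).trans (hB 0)
  rcases le_total R ‖ζ‖ with h1 | h1
  · rw [hR ζ h1, zero_mul, norm_zero]; positivity
  · rw [norm_mul]
    exact mul_le_mul (hB ζ) ((hC ζ (by simpa using h1)).trans (le_abs_self C)) (norm_nonneg _) hB0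

lemma integrable (hh : BoundedData h) : Integrable h := by
  obtain ⟨hm, ⟨B, hB⟩, R, hR⟩ := hh
  have : IntegrableOn h (Metric.ball 0 R) :=
    Measure.integrableOn_of_bounded (M := B) measure_ball_lt_top.ne
      hm.aestronglyMeasurable (Filter.Eventually.of_forall hB)
  refine (integrableOn_iff_integrable_of_support_subset fun ζ hζ => ?_).mp this
  by_contra hlt
  exact hζ (hR ζ (by simpa using hlt))

lemma integrable_mul_inv_sub (hh : BoundedData h) (z : ℂ) :
    Integrable fun ζ => h ζ * (z - ζ)⁻¹ := by
  obtain ⟨C, hC⟩ := (hh.mul_continuous (φ := fun ζ => ((1 + ‖z - ζ‖) ^ 2 : ℝ)) (by fun_prop)).bound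
  refine ((integrable_cauchyMajorant_sub z).const_mul C).mono'
    (by have := hh.measurable; fun_prop) (Filter.Eventually.of_forall fun ζ => ?_)
  have h1 := hC ζ
  rw [norm_mul, norm_real, Real.norm_of_nonneg (by positivity)] at h1
  have h2 : 0 < (1 + ‖z - ζ‖) ^ 2 := by positivity
  rw [norm_mul, norm_inv, cauchyMajorant, mul_inv, ← mul_assoc, mul_right_comm]
  gcongr
  rwa [le_mul_inv_iff₀ h2]

lemma integrable_norm_mul_cauchyMajorant (hh : BoundedData h) (z : ℂ) :
    Integrable fun ζ => ‖h ζ‖ * cauchyMajorant (z - ζ) := by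
  obtain ⟨B, hB⟩ := hh.bound
  refine (integrable_cauchyMajorant_sub z).bdd_mul (c := B)
    hh.measurable.norm.aestronglyMeasurable (Filter.Eventually.of_forall fun ζ => ?_)
  simpa using hB ζ

variable {K : Set ℂ}

lemma exists_approx_of_ball (hh : BoundedData h) (hK : IsCompact K) (hconn : IsPreconnected Kᶜ)
    {c : ℂ} (hc : c ∉ K) (hsupp : ∀ ζ ∉ Metric.ball c 2, h ζ = 0) :
    ∃ p, PolyApprox K p ∧ ∀ z ∈ K, ‖(∫ ζ, h ζ * (z - ζ)⁻¹) - p z‖ ≤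
      10 ^ 11 * ∫ ζ, ‖h ζ‖ * cauchyMajorant (z - ζ) := by
  obtain ⟨g, m, hg, hgm⟩ := exists_polyApprox_kernel hK hconn hc
  have hint : Integrable fun ζ => h ζ * (ζ - m) := (hh.mul_continuous (by fun_prop)).integrable
  refine ⟨fun z => (∫ ζ, h ζ) * g z + (∫ ζ, h ζ * (ζ - m)) * g z ^ 2,
    (hg.const_mul hK _).add ((hg.pow hK 2).const_mul hK _), fun z hz => ?_⟩
  have e1 : (∫ ζ, h ζ) * g z + (∫ ζ, h ζ * (ζ - m)) * g z ^ 2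
      = ∫ ζ, h ζ * (g z + (ζ - m) * g z ^ 2) := by
    rw [← integral_mul_const, ← integral_mul_const,
      ← integral_add (hh.integrable.mul_const _) (hint.mul_const _)]
    congr 1 with ζ
    ring
  have hint2 : Integrable fun ζ => h ζ * (g z + (ζ - m) * g z ^ 2) :=
    (hh.mul_continuous (by fun_prop)).integrable
  simp only []
  rw [e1, ← integral_sub (hh.integrable_mul_inv_sub z) hint2, ← integral_const_mul]
  refine norm_integral_le_of_norm_le ((hh.integrable_norm_mul_cauchyMajorant z).const_mul _) ?_
  filter_upwards [compl_mem_ae_iff.mpr (measure_singleton z)] with ζ hζ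
  rw [← mul_sub, norm_mul, mul_left_comm]
  by_cases hb : ζ ∈ Metric.ball c 2
  · exact mul_le_mul_of_nonneg_left (hgm z hz ζ hb fun h => hζ h.symm) (norm_nonneg _)
  · simp [hsupp ζ hb]

lemma exists_approx_of_finite_cover (hK : IsCompact K) (hconn : IsPreconnected Kᶜ) (t : Finset ℂ)
    (ht : ∀ c ∈ t, c ∉ K) (hh : BoundedData h)
    (hsupp : ∀ ζ, h ζ ≠ 0 → ∃ c ∈ t, ζ ∈ Metric.ball c 2) :
    ∃ p, PolyApprox K p ∧ ∀ z ∈ K, ‖(∫ ζ, h ζ * (z - ζ)⁻¹) - p z‖ ≤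
      10 ^ 11 * ∫ ζ, ‖h ζ‖ * cauchyMajorant (z - ζ) := by
  classical
  induction t using Finset.induction_on generalizing h with
  | empty =>
    have h0 : ∀ ζ, h ζ = 0 := fun ζ => by simpa using hsupp ζ
    exact ⟨fun _ => 0, PolyApprox.const 0, fun z _ => by simp [h0]⟩
  | insert c t _ ih =>
    have hb : MeasurableSet (Metric.ball c 2) := measurableSet_ball
    have hh1 := hh.indicator hb
    have hh2 := hh.indicator hb.compl
    obtain ⟨p, hp, hp'⟩ := hh1.exists_approx_of_ball hK hconn (ht c (by simp))
      (fun ζ hζ => indicator_of_notMem hζ h)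
    obtain ⟨q, hq, hq'⟩ := ih (fun a ha => ht a (by simp [ha])) hh2 (fun ζ hζ => by
      have hmem := mem_of_indicator_ne_zero hζ
      rw [indicator_of_mem hmem] at hζ
      obtain ⟨a, ha, haζ⟩ := hsupp ζ hζ
      rcases Finset.mem_insert.mp ha with rfl | ha
      · exact absurd haζ hmem
      · exact ⟨a, ha, haζ⟩)
    refine ⟨_, hp.add hq, fun z hz => ?_⟩
    have e1 : ∫ ζ, h ζ * (z - ζ)⁻¹ = (∫ ζ, (Metric.ball c 2).indicator h ζ * (z - ζ)⁻¹)
        + ∫ ζ, (Metric.ball c 2)ᶜ.indicator h ζ * (z - ζ)⁻¹ := by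
      rw [← integral_add (hh1.integrable_mul_inv_sub z) (hh2.integrable_mul_inv_sub z)]
      congr 1 with ζ
      rw [← add_mul, indicator_self_add_compl_apply]
    have e2 : ∫ ζ, ‖h ζ‖ * cauchyMajorant (z - ζ)
        = (∫ ζ, ‖(Metric.ball c 2).indicator h ζ‖ * cauchyMajorant (z - ζ))
        + ∫ ζ, ‖(Metric.ball c 2)ᶜ.indicator h ζ‖ * cauchyMajorant (z - ζ) := by
      rw [← integral_add (hh1.integrable_norm_mul_cauchyMajorant z)
        (hh2.integrable_norm_mul_cauchyMajorant z)]
      congr 1 with ζ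
      by_cases hζ : ζ ∈ Metric.ball c 2
      · rw [indicator_of_mem hζ, indicator_of_notMem (not_not.mpr hζ)]; simp
      · rw [indicator_of_notMem hζ, indicator_of_mem (by exact hζ)]; simp
    rw [e1, e2, add_sub_add_comm, mul_add]
    exact (norm_add_le _ _).trans (add_le_add (hp' z hz) (hq' z hz))

/-- Approximation of a Cauchy transform whose density lives close to the complement of `K`. -/
lemma exists_approx (hK : IsCompact K) (hconn : IsPreconnected Kᶜ) (hh : BoundedData h) {B : ℝ}
    (hB : ∀ ζ, ‖h ζ‖ ≤ B) (hsupp : ∀ ζ, h ζ ≠ 0 → ∃ c ∉ K, ‖ζ - c‖ < 1) :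
    ∃ p, PolyApprox K p ∧ ∀ z ∈ K, ‖(∫ ζ, h ζ * (z - ζ)⁻¹) - p z‖ ≤
      10 ^ 11 * (B * ∫ u, cauchyMajorant u) := by
  obtain ⟨R, hR⟩ := hh.support
  have hcomp : IsCompact (closure (Function.support h)) :=
    (Metric.isBounded_ball (x := (0 : ℂ)) (r := R)).subset (fun ζ hζ => by
      by_contra hlt
      exact hζ (hR ζ (by simpa using hlt))) |>.isCompact_closure
  obtain ⟨t, htK, htf, hcov⟩ := hcomp.elim_finite_subcover_image (b := Kᶜ)
    (c := fun c => Metric.ball c 2) (fun _ _ => Metric.isOpen_ball) (fun ζ hζ => by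
      obtain ⟨ξ, hξ, hd⟩ := Metric.mem_closure_iff.mp hζ 1 one_pos
      obtain ⟨c, hc, hcξ⟩ := hsupp ξ hξ
      refine mem_biUnion (show c ∈ Kᶜ from hc) (Metric.mem_ball.mpr ?_)
      rw [← dist_eq_norm] at hcξ
      linarith [dist_triangle ζ ξ c])
  obtain ⟨p, hp, hpz⟩ := exists_approx_of_finite_cover hK hconn htf.toFinset
    (fun c hc => htK (by simpa using hc)) hh (fun ζ hζ => by
      simpa using hcov (subset_closure hζ))
  refine ⟨p, hp, fun z hz => (hpz z hz).trans ?_⟩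
  gcongr
  rw [← integral_cauchyMajorant_sub z, ← integral_const_mul]
  refine integral_mono (hh.integrable_norm_mul_cauchyMajorant z)
    ((integrable_cauchyMajorant_sub z).const_mul B) fun ζ => ?_
  exact mul_le_mul_of_nonneg_right (hB ζ) (cauchyMajorant_nonneg _)

end BoundedData

lemma circleMap_norm_add_arg (v : ℂ) (θ : ℝ) :
    circleMap 0 ‖v‖ (θ + arg v) = v * exp (θ * I) := by
  conv_rhs => rw [← norm_mul_exp_arg_mul_I v]
  rw [circleMap, zero_add, mul_assoc, ← exp_add]
  push_cast
  ring_nf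

lemma measurePreserving_mul_exp (θ : ℝ) :
    MeasurePreserving (fun v : ℂ => v * exp (θ * I)) := by
  have h := (rotation (Circle.exp θ)).measurePreserving
  convert h using 1
  ext v
  simp [mul_comm]

lemma measurableEmbedding_mul_exp (θ : ℝ) :
    MeasurableEmbedding (fun v : ℂ => v * exp (θ * I)) :=
  (Homeomorph.mulRight₀ _ (exp_ne_zero (θ * I))).measurableEmbedding

/-- An integral over the plane does not change on averaging the integrand over circles. -/
lemma integral_circleAverage_norm {F : ℂ → ℂ} (hm : Measurable F) (hF : Integrable F) :
    ∫ v : ℂ, Real.circleAverage F 0 ‖v‖ = ∫ v, F v := by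
  have hrot : ∀ θ : ℝ, Integrable fun v => F (v * exp (θ * I)) := fun θ =>
    (measurePreserving_mul_exp θ).integrable_comp_of_integrable hF
  have hprod : Integrable (Function.uncurry fun (θ : ℝ) (v : ℂ) => F (v * exp (θ * I)))
      ((volume.restrict (uIoc 0 (2 * Real.pi))).prod volume) := by
    have hms : AEStronglyMeasurable (Function.uncurry fun (θ : ℝ) (v : ℂ) => F (v * exp (θ * I)))
        ((volume.restrict (uIoc 0 (2 * Real.pi))).prod volume) := by
      refine Measurable.aestronglyMeasurable ?_
      exact hm.comp (by fun_prop)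
    rw [integrable_prod_iff hms]
    refine ⟨Filter.Eventually.of_forall hrot, ?_⟩
    have : ∀ θ : ℝ, ∫ v, ‖F (v * exp (θ * I))‖ = ∫ v, ‖F v‖ := fun θ =>
      (measurePreserving_mul_exp θ).integral_comp (measurableEmbedding_mul_exp θ) (fun v => ‖F v‖)
    simp only [Function.uncurry, this]
    exact intervalIntegrable_iff.mp intervalIntegrable_const
  calc ∫ v : ℂ, Real.circleAverage F 0 ‖v‖
      = ∫ v, (2 * Real.pi)⁻¹ • ∫ θ in (0 : ℝ)..2 * Real.pi, F (v * exp (θ * I)) := by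
        congr 1 with v
        rw [Real.circleAverage_eq_integral_add (arg v)]
        simp_rw [circleMap_norm_add_arg]
    _ = (2 * Real.pi)⁻¹ • ∫ θ in (0 : ℝ)..2 * Real.pi, ∫ v, F (v * exp (θ * I)) := by
        rw [integral_smul, intervalIntegral_integral_swap hprod]
    _ = (2 * Real.pi)⁻¹ • ∫ θ in (0 : ℝ)..2 * Real.pi, ∫ v, F v := by
        congr 2 with θ
        exact (measurePreserving_mul_exp θ).integral_comp (measurableEmbedding_mul_exp θ) F
    _ = ∫ v, F v := by
        rw [intervalIntegral.integral_const, sub_zero, smul_smul, inv_mul_cancel₀, one_smul]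
        positivity

/-- The truncated identity: up to a factor, the `∂̄`-derivative of a radial mollifier. -/
noncomputable def discId : ℂ → ℂ := (Metric.ball 0 1).indicator fun v => v

lemma measurable_discId : Measurable discId := measurable_id.indicator measurableSet_ball

lemma discId_of_lt {v : ℂ} (hv : ‖v‖ < 1) : discId v = v :=
  indicator_of_mem (by simpa using hv) _

lemma discId_of_ge {v : ℂ} (hv : 1 ≤ ‖v‖) : discId v = 0 :=
  indicator_of_notMem (by simpa using hv) _

lemma norm_discId_le (v : ℂ) : ‖discId v‖ ≤ 1 := by
  rcases lt_or_ge ‖v‖ 1 with h | h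
  · rw [discId_of_lt h]; exact h.le
  · simp [discId_of_ge h]

lemma boundedData_discId : BoundedData discId :=
  ⟨measurable_discId, ⟨1, norm_discId_le⟩, 1, fun _ h => discId_of_ge h⟩

lemma circleAverage_discId_mul_of_ge {ρ : ℝ} (hρ : 1 ≤ |ρ|) (F : ℂ → ℂ) :
    Real.circleAverage (fun v => discId v * F v) 0 ρ = 0 := by
  rw [Real.circleAverage_congr_sphere (f₂ := fun _ => 0), Real.circleAverage_const]
  intro v hv
  simp only [mem_sphere_iff_norm, sub_zero] at hv
  simp [discId_of_ge (hρ.trans_eq hv.symm)]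

lemma circleAverage_discId_mul_of_diffContOnCl {ρ : ℝ} {F : ℂ → ℂ}
    (hF : DiffContOnCl ℂ F (Metric.ball 0 |ρ|)) :
    Real.circleAverage (fun v => discId v * F v) 0 ρ = 0 := by
  rcases le_or_gt 1 |ρ| with hρ | hρ
  · exact circleAverage_discId_mul_of_ge hρ F
  rw [Real.circleAverage_congr_sphere (f₂ := fun v => v • F v)]
  · have h := (differentiable_id.diffContOnCl.smul hF).circleAverage
    simpa using h
  · intro v hv
    simp only [mem_sphere_iff_norm, sub_zero] at hv
    simp [discId_of_lt (hv.trans_lt hρ)]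

lemma circleAverage_discId_mul_inv_sub {ρ : ℝ} {z : ℂ} (hz : ‖z‖ < |ρ|) (hρ : |ρ| < 1) :
    Real.circleAverage (fun v => discId v * (z - v)⁻¹) 0 ρ = -1 := by
  have h := (diffContOnCl_const (c := (-1 : ℂ)) (s := Metric.ball (0 : ℂ) |ρ|)
    (𝕜 := ℂ)).circleAverage_smul_div (R := ρ) (w := z) (by simpa using hz)
  rw [← h]
  refine Real.circleAverage_congr_sphere fun v hv => ?_
  simp only [mem_sphere_iff_norm, sub_zero] at hv
  simp only [discId_of_lt (hv.trans_lt hρ), sub_zero, smul_eq_mul]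
  rw [← neg_sub v z, inv_neg]
  ring

/-- The (unnormalised) radial mollifier `z ↦ π (1 - |z|²)₊`. -/
noncomputable def mollifier (z : ℂ) : ℝ := Real.pi * max (1 - ‖z‖ ^ 2) 0

lemma integral_discId_mul_inv_sub (z : ℂ) :
    ∫ v, discId v * (z - v)⁻¹ = -(mollifier z : ℂ) := by
  rw [← integral_circleAverage_norm (by have := measurable_discId; fun_prop)
    (boundedData_discId.integrable_mul_inv_sub z)]
  have hae : (fun v : ℂ => Real.circleAverage (fun v => discId v * (z - v)⁻¹) 0 ‖v‖) =ᵐ[volume]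
      (Metric.ball 0 1 \ Metric.closedBall 0 ‖z‖).indicator fun _ => (-1 : ℂ) := by
    filter_upwards [compl_mem_ae_iff.mpr
      (Measure.addHaar_sphere (volume : Measure ℂ) 0 ‖z‖)] with v hv
    have hv : ‖v‖ ≠ ‖z‖ := by simpa using hv
    rcases lt_or_gt_of_ne hv with h | h
    · rw [indicator_of_notMem (by simp [h.le])]
      refine circleAverage_discId_mul_of_diffContOnCl ⟨?_, ?_⟩
      · refine (differentiableOn_const z |>.sub differentiableOn_id).inv fun w hw => ?_
        rw [mem_ball_zero_iff, abs_norm] at hw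
        exact sub_ne_zero.mpr fun e => by simp [e] at h; exact (hw.trans h).false
      · refine (continuousOn_const.sub continuousOn_id).inv₀ fun w hw => ?_
        have hw := Metric.closure_ball_subset_closedBall hw
        rw [mem_closedBall_zero_iff, abs_norm] at hw
        exact sub_ne_zero.mpr fun e => by simp [e] at h; exact (hw.trans_lt h).false
    · rcases lt_or_ge ‖v‖ 1 with h1 | h1
      · rw [indicator_of_mem (by simp [h1, h])]
        exact circleAverage_discId_mul_inv_sub (by simpa using h) (by simpa using h1)
      · rw [indicator_of_notMem (by simp [h1])]
        exact circleAverage_discId_mul_of_ge (by simpa using h1) _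
  rw [integral_congr_ae hae, integral_indicator (by measurability), setIntegral_const, smul_neg,
    neg_inj]
  simp only [real_smul, mul_one, mollifier]
  congr 1
  rcases le_or_gt 1 ‖z‖ with h | h
  · rw [max_eq_right (by nlinarith), mul_zero, sdiff_eq_empty.mpr, measureReal_empty]
    exact Metric.ball_subset_closedBall.trans (Metric.closedBall_subset_closedBall h)
  · rw [max_eq_left (by nlinarith [norm_nonneg z]),
      measureReal_sdiff (Metric.closedBall_subset_ball h) measurableSet_closedBall,
      Measure.real, Measure.real, Complex.volume_ball, Complex.volume_closedBall]
    simp [ENNReal.toReal_mul]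
    ring

lemma mollifier_nonneg (z : ℂ) : 0 ≤ mollifier z :=
  mul_nonneg Real.pi_pos.le (le_max_right _ _)

lemma continuous_mollifier : Continuous mollifier := by unfold mollifier; fun_prop

lemma mollifier_of_ge {z : ℂ} (hz : 1 ≤ ‖z‖) : mollifier z = 0 := by
  rw [mollifier, max_eq_right (by nlinarith), mul_zero]

lemma hasCompactSupport_mollifier : HasCompactSupport mollifier :=
  HasCompactSupport.intro (isCompact_closedBall 0 1) fun z hz =>
    mollifier_of_ge (by simpa using (not_le.mp (by simpa using hz) : 1 < ‖z‖).le)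

lemma integrable_mollifier : Integrable mollifier :=
  continuous_mollifier.integrable_of_hasCompactSupport hasCompactSupport_mollifier

lemma integral_mollifier_pos : 0 < ∫ z, mollifier z :=
  continuous_mollifier.integral_pos_of_hasCompactSupport_nonneg_nonzero
    hasCompactSupport_mollifier mollifier_nonneg (x := 0)
    (by simp [mollifier, Real.pi_ne_zero])

lemma integral_discId : ∫ v, discId v = 0 := by
  rw [← integral_circleAverage_norm measurable_discId boundedData_discId.integrable]
  have : ∀ v : ℂ, Real.circleAverage discId 0 ‖v‖ = 0 := fun v => by
    simpa using circleAverage_discId_mul_of_diffContOnCl (ρ := ‖v‖) (F := fun _ => 1)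
      diffContOnCl_const
  simp [this]

lemma integral_norm_discId_le : ∫ v, ‖discId v‖ ≤ Real.pi := by
  calc ∫ v, ‖discId v‖ ≤ ∫ v : ℂ, (Metric.ball (0 : ℂ) 1).indicator (fun _ => (1 : ℝ)) v := by
        refine integral_mono boundedData_discId.integrable.norm ?_ fun v => ?_
        · exact (integrable_indicator_iff measurableSet_ball).mpr
            (integrableOn_const measure_ball_lt_top.ne)
        · rcases lt_or_ge ‖v‖ 1 with h | h
          · rw [indicator_of_mem (by simpa using h)]; exact norm_discId_le v
          · rw [discId_of_ge h, indicator_of_notMem (by simpa using h), norm_zero]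
    _ = Real.pi := by
        rw [integral_indicator measurableSet_ball, setIntegral_const, Measure.real,
          Complex.volume_ball]
        simp

/-- The convolution of `f` with the truncated identity: up to a factor, the `∂̄`-derivative of
a mollification of `f`. -/
noncomputable def dbarMollify (f : ℂ → ℂ) (ζ : ℂ) : ℂ := ∫ v, discId v * f (ζ - v)

section dbarMollify

variable {f : ℂ → ℂ}

lemma dbarMollify_eq_integral_sub (ζ : ℂ) : dbarMollify f ζ = ∫ u, discId (ζ - u) * f u := by
  rw [dbarMollify, ← integral_sub_left_eq_self _ _ ζ]
  simp

lemma norm_dbarMollify_le (hf : Continuous f) {ω : ℝ}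
    (hω : ∀ z w, ‖z - w‖ ≤ 1 → ‖f z - f w‖ ≤ ω) (ζ : ℂ) : ‖dbarMollify f ζ‖ ≤ Real.pi * ω := by
  have hω0 : 0 ≤ ω := (norm_nonneg _).trans (hω 0 0 (by simp))
  have h1 : dbarMollify f ζ = ∫ v, discId v * (f (ζ - v) - f ζ) := by
    simp_rw [mul_sub]
    rw [integral_sub (boundedData_discId.mul_continuous (by fun_prop)).integrable
      (boundedData_discId.integrable.mul_const _), integral_mul_const, integral_discId, zero_mul,
      sub_zero, dbarMollify]
  rw [h1]
  calc _ ≤ ∫ v, ‖discId v‖ * ω := by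
        refine norm_integral_le_of_norm_le (boundedData_discId.integrable.norm.mul_const _)
          (Filter.Eventually.of_forall fun v => ?_)
        rw [norm_mul]
        rcases lt_or_ge ‖v‖ 1 with h | h
        · exact mul_le_mul_of_nonneg_left (hω _ _ (by simpa using h.le)) (norm_nonneg _)
        · simp [discId_of_ge h]
    _ ≤ Real.pi * ω := by
        rw [integral_mul_const]
        exact mul_le_mul_of_nonneg_right integral_norm_discId_le hω0

lemma dbarMollify_eq_zero_of_ball_subset {K : Set ℂ} (hf : Continuous f)
    (hd : DifferentiableOn ℂ f (interior K)) {ζ : ℂ} (hζ : Metric.ball ζ 1 ⊆ K) :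
    dbarMollify f ζ = 0 := by
  have hm : Measurable fun v => discId v * f (ζ - v) :=
    measurable_discId.mul (by fun_prop)
  rw [dbarMollify, ← integral_circleAverage_norm hm
    (boundedData_discId.mul_continuous (by fun_prop)).integrable]
  have : ∀ v : ℂ, Real.circleAverage (fun v => discId v * f (ζ - v)) 0 ‖v‖ = 0 := fun v => by
    rcases lt_or_ge ‖v‖ 1 with h | h
    · refine circleAverage_discId_mul_of_diffContOnCl ⟨?_, by fun_prop⟩
      refine hd.comp (by fun_prop) fun w hw => ?_
      refine interior_maximal hζ Metric.isOpen_ball ?_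
      rw [mem_ball_zero_iff, abs_norm] at hw
      simpa using hw.trans h
    · exact circleAverage_discId_mul_of_ge (by simpa using h) _
  simp [this]

lemma dbarMollify_eq_zero_of_le {R : ℝ} (hR : ∀ z, R ≤ ‖z‖ → f z = 0) {ζ : ℂ}
    (hζ : R + 1 ≤ ‖ζ‖) : dbarMollify f ζ = 0 := by
  rw [dbarMollify]
  refine integral_eq_zero_of_ae (Filter.Eventually.of_forall fun v => ?_)
  rcases lt_or_ge ‖v‖ 1 with h | h
  · simp [hR (ζ - v) (by linarith [norm_sub_norm_le ζ v])]
  · simp [discId_of_ge h]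

lemma boundedData_dbarMollify (hf : Continuous f) {ω R : ℝ}
    (hω : ∀ z w, ‖z - w‖ ≤ 1 → ‖f z - f w‖ ≤ ω) (hR : ∀ z, R ≤ ‖z‖ → f z = 0) :
    BoundedData (dbarMollify f) := by
  refine ⟨?_, ⟨_, norm_dbarMollify_le hf hω⟩, _, fun ζ => dbarMollify_eq_zero_of_le hR⟩
  refine (StronglyMeasurable.integral_prod_right
    (f := fun ζ v => discId v * f (ζ - v)) ?_).measurable
  refine Measurable.stronglyMeasurable ?_
  have := measurable_discId
  exact (this.comp measurable_snd).mul (hf.measurable.comp (by fun_prop))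

/-- The Cauchy transform of `dbarMollify f` is a mollification of `f`. -/
lemma integral_dbarMollify_mul_inv_sub (hf : Continuous f) (hs : HasCompactSupport f) {R : ℝ}
    (hR : ∀ z, R ≤ ‖z‖ → f z = 0) (z : ℂ) :
    ∫ ζ, dbarMollify f ζ * (z - ζ)⁻¹ = -∫ v, (mollifier v : ℂ) * f (z - v) := by
  have hmd := measurable_discId
  have hfm := hf.measurable
  have hind : BoundedData ((Metric.ball (0 : ℂ) (R + 1)).indicator fun _ => (1 : ℂ)) := by
    refine ⟨measurable_const.indicator measurableSet_ball, ⟨1, fun ζ => ?_⟩, R + 1, fun ζ h => ?_⟩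
    · exact (norm_indicator_le_norm_self _ ζ).trans (by simp)
    · exact indicator_of_notMem (by simpa using h) _
  have hint : Integrable (Function.uncurry fun ζ u : ℂ => discId (ζ - u) * f u * (z - ζ)⁻¹)
      (volume.prod volume) := by
    refine ((hind.integrable_mul_inv_sub z).norm.mul_prod
      (hf.integrable_of_hasCompactSupport hs).norm).mono'
      (Measurable.aestronglyMeasurable ?_) (Filter.Eventually.of_forall fun q => ?_)
    · exact ((hmd.comp (by fun_prop)).mul (hfm.comp (by fun_prop))).mul (by fun_prop)
    · obtain ⟨ζ, u⟩ := q
      simp only [Function.uncurry, norm_mul]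
      by_cases h : ‖ζ‖ < R + 1
      · rw [indicator_of_mem (by simpa using h), norm_one, one_mul, mul_comm]
        refine mul_le_mul_of_nonneg_left ?_ (norm_nonneg _)
        exact mul_le_of_le_one_left (norm_nonneg _) (norm_discId_le _)
      · have : discId (ζ - u) * f u = 0 := by
          rcases lt_or_ge ‖ζ - u‖ 1 with h1 | h1
          · rw [hR u (by linarith [norm_sub_norm_le ζ u]), mul_zero]
          · rw [discId_of_ge h1, zero_mul]
        rw [← norm_mul (discId _), this]
        simp only [norm_zero, zero_mul]
        positivity
  calc ∫ ζ, dbarMollify f ζ * (z - ζ)⁻¹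
      = ∫ ζ, ∫ u, discId (ζ - u) * f u * (z - ζ)⁻¹ := by
        simp_rw [dbarMollify_eq_integral_sub, integral_mul_const]
    _ = ∫ u, ∫ ζ, discId (ζ - u) * f u * (z - ζ)⁻¹ := integral_integral_swap hint
    _ = ∫ u, -((mollifier (z - u) : ℂ) * f u) := by
        congr 1 with u
        rw [← neg_mul, ← integral_discId_mul_inv_sub, ← integral_mul_const,
          ← integral_sub_right_eq_self (fun v => discId v * (z - u - v)⁻¹ * f u) u]
        congr 1 with ζ
        rw [sub_sub_sub_cancel_right]
        ring
    _ = -∫ v, (mollifier v : ℂ) * f (z - v) := by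
        rw [integral_neg, ← integral_sub_left_eq_self _ _ z]
        simp

lemma norm_integral_mollifier_mul_sub_le (hf : Continuous f) {ω : ℝ}
    (hω : ∀ z w, ‖z - w‖ ≤ 1 → ‖f z - f w‖ ≤ ω) (z : ℂ) :
    ‖(∫ v, (mollifier v : ℂ) * f (z - v)) - ((∫ v, mollifier v : ℝ) : ℂ) * f z‖ ≤
      (∫ v, mollifier v) * ω := by
  have hc : Continuous fun v => (mollifier v : ℂ) := continuous_ofReal.comp continuous_mollifier
  have hsc : HasCompactSupport fun v => (mollifier v : ℂ) :=
    hasCompactSupport_mollifier.comp_left ofReal_zero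
  rw [← integral_complex_ofReal, ← integral_mul_const, ← integral_sub, ← integral_mul_const]
  · refine norm_integral_le_of_norm_le (integrable_mollifier.mul_const _)
      (Filter.Eventually.of_forall fun v => ?_)
    rw [← mul_sub, norm_mul, norm_real, Real.norm_of_nonneg (mollifier_nonneg v)]
    rcases lt_or_ge ‖v‖ 1 with h | h
    · exact mul_le_mul_of_nonneg_left (hω _ _ (by simpa using h.le)) (mollifier_nonneg v)
    · simp [mollifier_of_ge h]
  · exact (hc.mul (by fun_prop)).integrable_of_hasCompactSupport hsc.mul_right
  · exact integrable_mollifier.ofReal.mul_const _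

end dbarMollify

/-- The key step of Mergelyan's theorem: approximation up to a constant times the oscillation of
`f` at unit scale, with a universal constant. -/
lemma exists_polyApprox_of_oscillation : ∃ C : ℝ, 0 ≤ C ∧ ∀ (K : Set ℂ), IsCompact K →
    IsPreconnected Kᶜ → ∀ (f : ℂ → ℂ), Continuous f → HasCompactSupport f →
    DifferentiableOn ℂ f (interior K) → ∀ ω : ℝ, (∀ z w, ‖z - w‖ ≤ 1 → ‖f z - f w‖ ≤ ω) →
    ∃ p, PolyApprox K p ∧ ∀ z ∈ K, ‖f z - p z‖ ≤ C * ω := by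
  set α : ℝ := ∫ v, mollifier v with hα
  have hα0 : 0 < α := integral_mollifier_pos
  set M : ℝ := ∫ u, cauchyMajorant u with hM
  have hM0 : 0 ≤ M := integral_nonneg cauchyMajorant_nonneg
  refine ⟨α⁻¹ * (10 ^ 11 * (Real.pi * M)) + 1, by positivity, ?_⟩
  intro K hK hconn f hf hs hd ω hω
  obtain ⟨R, hR⟩ : ∃ R, ∀ z, R ≤ ‖z‖ → f z = 0 := by
    obtain ⟨R, hR⟩ := hs.isCompact.isBounded.exists_norm_le
    refine ⟨R + 1, fun z hz => image_eq_zero_of_notMem_tsupport fun h => ?_⟩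
    linarith [hR z h]
  obtain ⟨p, hp, hpz⟩ := (boundedData_dbarMollify hf hω hR).exists_approx hK hconn
    (norm_dbarMollify_le hf hω) fun ζ hζ => by
      by_contra! hcon
      refine hζ (dbarMollify_eq_zero_of_ball_subset hf hd fun c hc => ?_)
      by_contra hcK
      have := hcon c hcK
      rw [Metric.mem_ball, dist_eq_norm, norm_sub_rev] at hc
      linarith
  refine ⟨fun z => (-(α : ℂ)⁻¹) * p z, hp.const_mul hK _, fun z hz => ?_⟩
  have h1 := hpz z hz
  have h2 := norm_integral_mollifier_mul_sub_le hf hω z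
  rw [integral_dbarMollify_mul_inv_sub hf hs hR] at h1
  set J := ∫ v, (mollifier v : ℂ) * f (z - v)
  have hαc : (α : ℂ) ≠ 0 := by exact_mod_cast hα0.ne'
  have h3 : f z - -(α : ℂ)⁻¹ * p z = -(α : ℂ)⁻¹ * ((-J - p z) + (J - α * f z)) := by
    field_simp
    ring
  rw [h3, norm_mul, norm_neg, norm_inv, norm_real, Real.norm_of_nonneg hα0.le]
  calc α⁻¹ * ‖(-J - p z) + (J - α * f z)‖
      ≤ α⁻¹ * (10 ^ 11 * (Real.pi * ω * M) + α * ω) :=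
        mul_le_mul_of_nonneg_left ((norm_add_le _ _).trans (add_le_add h1 h2)) (by positivity)
    _ = _ := by field_simp

lemma PolyApprox.of_comp_mul_left {K : Set ℂ} {p : ℂ → ℂ} {c : ℂ} (hc : c ≠ 0)
    (hp : PolyApprox ((fun z => c * z) ⁻¹' K) p) : PolyApprox K fun z => p (c⁻¹ * z) := by
  intro ε hε
  obtain ⟨q, hq⟩ := hp ε hε
  refine ⟨q.comp (Polynomial.C c⁻¹ * Polynomial.X), fun z hz => ?_⟩
  simpa using hq (c⁻¹ * z) (by simpa [hc] using hz)

lemma exists_continuous_extension {K : Set ℂ} (hK : IsCompact K) {f : ℂ → ℂ}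
    (hf : ContinuousOn f K) :
    ∃ g : ℂ → ℂ, Continuous g ∧ HasCompactSupport g ∧ EqOn g f K := by
  obtain ⟨g, hg⟩ := ContinuousMap.exists_restrict_eq hK.isClosed ⟨K.domRestrict f, hf.domRestrict⟩
  obtain ⟨χ, hχ, -, hχs, -⟩ := exists_continuous_one_zero_of_isCompact hK isClosed_empty
    (disjoint_empty K)
  refine ⟨fun z => (χ z : ℂ) * g z, by fun_prop, ?_, fun z hz => ?_⟩
  · exact (hχs.comp_left (g := fun x : ℝ => (x : ℂ)) ofReal_zero).mul_right
  · have : g z = f z := DFunLike.congr_fun hg ⟨z, hz⟩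
    simp [hχ hz, this]

/-- **Mergelyan's theorem** -/
theorem polyApprox_of_isPreconnected_compl {K : Set ℂ} (hK : IsCompact K)
    (hconn : IsPreconnected Kᶜ) {f : ℂ → ℂ} (hf : ContinuousOn f K)
    (hd : DifferentiableOn ℂ f (interior K)) : PolyApprox K f := by
  obtain ⟨g, hg, hgs, hgf⟩ := exists_continuous_extension hK hf
  obtain ⟨C, hC0, hC⟩ := exists_polyApprox_of_oscillation
  refine PolyApprox.congr (f := g) (PolyApprox.of_approx fun ε hε => ?_) fun z hz => (hgf hz).symm
  obtain ⟨δ, hδ, hδg⟩ := Metric.uniformContinuous_iff.mp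
    (hgs.uniformContinuous_of_continuous hg) (ε / (C + 1)) (by positivity)
  have hδc : ((δ / 2 : ℝ) : ℂ) ≠ 0 := by exact_mod_cast (half_pos hδ).ne'
  set c : ℂ := ((δ / 2 : ℝ) : ℂ) with hc
  have hcn : ‖c‖ = δ / 2 := by rw [hc, norm_real, Real.norm_of_nonneg (by positivity)]
  set e : ℂ ≃ₜ ℂ := Homeomorph.mulLeft₀ c hδc
  obtain ⟨p, hp, hpg⟩ := hC (e ⁻¹' K) (e.isCompact_preimage.mpr hK)
    (by rw [← preimage_compl]; exact e.isPreconnected_preimage.mpr hconn)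
    (g ∘ e) (hg.comp e.continuous) (hgs.comp_homeomorph e)
    (by
      rw [← e.preimage_interior]
      exact (hd.congr fun z hz => hgf (interior_subset hz)).comp
        (differentiable_id.const_mul c).differentiableOn (mapsTo_preimage _ _))
    (ε / (C + 1)) (fun z w hzw => by
      rw [← dist_eq_norm]
      refine (hδg ?_).le
      change dist (c * z) (c * w) < δ
      rw [dist_eq_norm, ← mul_sub, norm_mul, hcn]
      nlinarith)
  refine ⟨_, hp.of_comp_mul_left hδc, fun z hz => ?_⟩
  have hez : e (c⁻¹ * z) = z := mul_inv_cancel_left₀ hδc z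
  have := hpg (c⁻¹ * z) (by rw [mem_preimage, hez]; exact hz)
  rw [Function.comp_apply, hez] at this
  refine this.trans_lt ?_
  rw [mul_div_assoc', div_lt_iff₀ (by positivity)]
  nlinarith

section Zeros

variable {F : Type*} [NormedAddCommGroup F] [NormedSpace ℂ F]

lemma exists_eq_prod_sub_smul [CompleteSpace F] (S : Finset ℂ) {G : ℂ → F}
    (hG : Differentiable ℂ G) (h0 : ∀ a ∈ S, G a = 0) :
    ∃ H : ℂ → F, Differentiable ℂ H ∧ ∀ s, G s = (∏ a ∈ S, (s - a)) • H s := by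
  classical
  induction S using Finset.induction_on with
  | empty => exact ⟨G, hG, by simp⟩
  | insert a S ha ih =>
    obtain ⟨H, hH, hGH⟩ := ih fun b hb => h0 b (Finset.mem_insert_of_mem hb)
    have hHa : H a = 0 := by
      have := h0 a (Finset.mem_insert_self a S)
      rw [hGH, smul_eq_zero, Finset.prod_eq_zero_iff] at this
      refine this.resolve_left ?_
      rintro ⟨b, hb, hab⟩
      exact ha (sub_eq_zero.mp hab ▸ hb)
    refine ⟨dslope H a, ?_, fun s => ?_⟩
    · rw [← differentiableOn_univ] at hH ⊢
      exact (Complex.differentiableOn_dslope Filter.univ_mem).mpr hH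
    · rw [hGH, Finset.prod_insert ha, mul_comm, mul_smul, sub_smul_dslope, hHa, sub_zero]

/-- A Schwarz-type estimate for an entire function with many zeros in a disc. -/
lemma norm_le_of_zeros [CompleteSpace F] {S : Finset ℂ} {G : ℂ → F} (hG : Differentiable ℂ G)
    (h0 : ∀ a ∈ S, G a = 0) {L M : ℝ} (hL : 0 < L) (hS : ∀ a ∈ S, ‖a‖ ≤ L)
    (hM : ∀ s, ‖s‖ = 4 * L → ‖G s‖ ≤ M) {s : ℂ} (hs : ‖s‖ ≤ L) :
    ‖G s‖ ≤ M * (2 / 3) ^ S.card := by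
  obtain ⟨H, hH, hGH⟩ := exists_eq_prod_sub_smul S hG h0
  have hfr : ∀ w ∈ frontier (Metric.ball (0 : ℂ) (4 * L)), ‖H w‖ ≤ M / (3 * L) ^ S.card := by
    intro w hw
    rw [frontier_ball _ (by positivity), mem_sphere_zero_iff_norm] at hw
    have h1 : (3 * L) ^ S.card ≤ ‖∏ a ∈ S, (w - a)‖ := by
      rw [norm_prod, ← Finset.prod_const]
      refine Finset.prod_le_prod (fun _ _ => by positivity) fun a ha => ?_
      linarith [norm_sub_norm_le w a, hS a ha]
    rw [le_div_iff₀ (by positivity), mul_comm]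
    calc (3 * L) ^ S.card * ‖H w‖ ≤ ‖∏ a ∈ S, (w - a)‖ * ‖H w‖ := by gcongr
      _ = ‖G w‖ := by rw [hGH, norm_smul]
      _ ≤ M := hM w hw
  have hHs : ‖H s‖ ≤ M / (3 * L) ^ S.card :=
    Complex.norm_le_of_forall_mem_frontier_norm_le Metric.isBounded_ball hH.diffContOnCl hfr
      (subset_closure (by rw [mem_ball_zero_iff]; linarith))
  have h2 : ‖∏ a ∈ S, (s - a)‖ ≤ (2 * L) ^ S.card := by
    rw [norm_prod, ← Finset.prod_const]
    refine Finset.prod_le_prod (fun _ _ => by positivity) fun a ha => ?_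
    linarith [norm_sub_le s a, hS a ha]
  calc ‖G s‖ = ‖∏ a ∈ S, (s - a)‖ * ‖H s‖ := by rw [hGH, norm_smul]
    _ ≤ (2 * L) ^ S.card * (M / (3 * L) ^ S.card) := by gcongr
    _ = M * (2 / 3) ^ S.card := by
      rw [mul_div_left_comm, ← div_pow]
      congr 2
      field_simp

/-- An entire function of exponential type that vanishes at all `log k` is zero. -/
lemma eq_zero_of_zeros_log [CompleteSpace F] {G : ℂ → F} (hG : Differentiable ℂ G)
    (h0 : ∀ k : ℕ, 1 ≤ k → G (Real.log k) = 0) {C R : ℝ}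
    (hGb : ∀ s, ‖G s‖ ≤ C * Real.exp (R * ‖s‖)) (s : ℂ) : G s = 0 := by
  classical
  obtain ⟨m, hm⟩ := exists_nat_ge R
  have hC : 0 ≤ C := by
    have := (norm_nonneg _).trans (hGb 0)
    simpa using this
  have hlim : Filter.Tendsto (fun N : ℕ => C * ((N : ℝ) ^ (4 * m) * (2 / 3 : ℝ) ^ N))
      Filter.atTop (nhds (C * 0)) :=
    (tendsto_pow_const_mul_const_pow_of_abs_lt_one (4 * m) (by norm_num [abs_lt])).const_mul C
  have hlog : Filter.Tendsto (fun N : ℕ => Real.log N) Filter.atTop Filter.atTop :=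
    Real.tendsto_log_atTop.comp tendsto_natCast_atTop_atTop
  rw [← norm_le_zero_iff, ← mul_zero C]
  refine ge_of_tendsto hlim ?_
  filter_upwards [hlog.eventually_ge_atTop ‖s‖, hlog.eventually_gt_atTop 0,
    Filter.eventually_ge_atTop 1] with N hsN hLN hN1
  have hN : (0 : ℝ) < N := by exact_mod_cast hN1
  set S : Finset ℂ := (Finset.Icc 1 N).image fun k : ℕ => (Real.log k : ℂ) with hS
  have hcard : S.card = N := by
    rw [hS, Finset.card_image_of_injOn, Nat.card_Icc, Nat.add_sub_cancel]
    intro j hj k hk hjk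
    simp only [Finset.coe_Icc, mem_Icc] at hj hk
    have := Real.log_injOn_pos (mem_Ioi.mpr (by exact_mod_cast hj.1))
      (mem_Ioi.mpr (by exact_mod_cast hk.1)) (ofReal_injective hjk)
    exact_mod_cast this
  have hmain := norm_le_of_zeros (S := S) (L := Real.log N)
    (M := C * Real.exp (m * (4 * Real.log N))) hG
    (fun a ha => by
      obtain ⟨k, hk, rfl⟩ := Finset.mem_image.mp ha
      exact h0 k (Finset.mem_Icc.mp hk).1) hLN
    (fun a ha => by
      obtain ⟨k, hk, rfl⟩ := Finset.mem_image.mp ha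
      rw [Finset.mem_Icc] at hk
      have hk1 : (1 : ℝ) ≤ k := by exact_mod_cast hk.1
      rw [norm_real, Real.norm_of_nonneg (Real.log_nonneg hk1)]
      exact Real.log_le_log (by linarith) (by exact_mod_cast hk.2))
    (fun w hw => (hGb w).trans (by rw [hw]; gcongr)) hsN
  refine hmain.trans_eq ?_
  have hexp : Real.exp (m * (4 * Real.log N)) = (N : ℝ) ^ (4 * m) := by
    rw [← Real.exp_log (pow_pos hN _), Real.log_pow]
    push_cast
    ring_nf
  rw [hcard, mul_assoc, hexp]

end Zeros

namespace IsDirichletPolynomial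

variable {f g : ℂ → ℂ}

lemma zero : IsDirichletPolynomial fun _ => 0 := ⟨0, 0, by simp⟩

lemma natCast_cpow {k : ℕ} (hk : 1 ≤ k) : IsDirichletPolynomial fun z => (k : ℂ) ^ (-z) := by
  refine ⟨k, fun j => if j = k then 1 else 0, fun z => ?_⟩
  simp [hk]

lemma const_mul (c : ℂ) (hf : IsDirichletPolynomial f) :
    IsDirichletPolynomial fun z => c * f z := by
  obtain ⟨m, a, ha⟩ := hf
  refine ⟨m, fun k => c * a k, fun z => ?_⟩
  simp only [ha, Finset.mul_sum, mul_assoc]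

lemma add (hf : IsDirichletPolynomial f) (hg : IsDirichletPolynomial g) :
    IsDirichletPolynomial fun z => f z + g z := by
  have extend : ∀ {h : ℂ → ℂ} {m n : ℕ} {a : ℕ → ℂ}, m ≤ n →
      (∀ z, h z = ∑ k ∈ Finset.Icc 1 m, a k * (k : ℂ) ^ (-z)) →
      ∀ z, h z = ∑ k ∈ Finset.Icc 1 n, (if k ≤ m then a k else 0) * (k : ℂ) ^ (-z) := by
    intro h m n a hmn hh z
    simp only [ite_mul, zero_mul, ← Finset.sum_filter]
    rw [hh]
    refine Finset.sum_congr ?_ fun _ _ => rfl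
    ext k
    simp only [Finset.mem_Icc, Finset.mem_filter]
    omega
  obtain ⟨m, a, ha⟩ := hf
  obtain ⟨n, b, hb⟩ := hg
  refine ⟨max m n, fun k => (if k ≤ m then a k else 0) + (if k ≤ n then b k else 0),
    fun z => ?_⟩
  simp only [add_mul, Finset.sum_add_distrib]
  rw [extend (le_max_left m n) ha, extend (le_max_right m n) hb]

lemma differentiable (hf : IsDirichletPolynomial f) : Differentiable ℂ f := by
  obtain ⟨m, a, ha⟩ := hf
  rw [show f = fun z => ∑ k ∈ Finset.Icc 1 m, a k * (k : ℂ) ^ (-z) from funext ha]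
  refine Differentiable.fun_sum fun k hk => Differentiable.const_mul ?_ _
  have hk0 : (k : ℂ) ≠ 0 := by
    have := (Finset.mem_Icc.mp hk).1
    exact_mod_cast (by omega : k ≠ 0)
  exact differentiable_neg.const_cpow (Or.inl hk0)

end IsDirichletPolynomial

section Exponential

variable {K : Set ℂ} [CompactSpace K]

/-- The exponential `z ↦ exp (-s z)` as a continuous function on `K`. -/
noncomputable def expOn (K : Set ℂ) (s : ℂ) : C(K, ℂ) := ⟨fun z => exp (s * -z), by fun_prop⟩

/-- The function `z ↦ -z` as a continuous function on `K`. -/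
def negOn (K : Set ℂ) : C(K, ℂ) := ⟨fun z => -z, by fun_prop⟩

lemma expOn_eq_exp (s : ℂ) : expOn K s = NormedSpace.exp (s • negOn K) := by
  let _ : NormedAlgebra ℚ C(K, ℂ) := NormedAlgebra.restrictScalars ℚ ℂ C(K, ℂ)
  ext z
  have := NormedSpace.map_exp (ContinuousMap.evalAlgHom ℂ ℂ z)
    (continuous_eval_const z) (s • negOn K)
  simp only [ContinuousMap.evalAlgHom_apply] at this
  erw [this]
  rw [← exp_eq_exp_ℂ]
  rfl

lemma hasDerivAt_expOn (s : ℂ) : HasDerivAt (expOn K) (expOn K s * negOn K) s := by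
  rw [funext (expOn_eq_exp (K := K))]
  exact hasDerivAt_exp_smul_const (negOn K) s

lemma norm_expOn_le (s : ℂ) : ‖expOn K s‖ ≤ Real.exp (‖negOn K‖ * ‖s‖) := by
  rw [ContinuousMap.norm_le _ (Real.exp_pos _).le]
  intro z
  refine (norm_exp_le_exp_norm _).trans (Real.exp_le_exp.mpr ?_)
  rw [norm_mul, mul_comm]
  exact mul_le_mul_of_nonneg_right ((negOn K).norm_coe_le_norm z) (norm_nonneg _)

lemma clm_expOn_mul_pow_eq_zero {F : Type*} [NormedAddCommGroup F] [NormedSpace ℂ F]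
    [CompleteSpace F] {T : C(K, ℂ) →L[ℂ] F}
    (hT : ∀ k : ℕ, 1 ≤ k → T (expOn K (Real.log k)) = 0) (n : ℕ) (s : ℂ) :
    T (expOn K s * negOn K ^ n) = 0 := by
  induction n generalizing s with
  | zero =>
    rw [pow_zero, mul_one]
    refine eq_zero_of_zeros_log (G := fun s => T (expOn K s)) (C := ‖T‖) (R := ‖negOn K‖)
      (fun w => (T.hasFDerivAt.comp_hasDerivAt w (hasDerivAt_expOn w)).differentiableAt) hT
      (fun w => (T.le_opNorm _).trans ?_) s
    exact mul_le_mul_of_nonneg_left (norm_expOn_le w) (norm_nonneg _)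
  | succ n ih =>
    have h := T.hasFDerivAt.comp_hasDerivAt s ((hasDerivAt_expOn s).mul_const (negOn K ^ n))
    have h0 : (T ∘ fun w => expOn K w * negOn K ^ n) = fun _ => 0 := funext ih
    rw [h0] at h
    rw [pow_succ', ← mul_assoc]
    exact h.unique (hasDerivAt_const s 0)

end Exponential

/-- `f` is a uniform limit of Dirichlet polynomials on `K`. -/
def DirichletApprox (K : Set ℂ) (f : ℂ → ℂ) : Prop :=
  ∀ ε > 0, ∃ D : ℂ → ℂ, IsDirichletPolynomial D ∧ ∀ z ∈ K, ‖f z - D z‖ < ε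

/-- The continuous functions on `K` that are restrictions of Dirichlet polynomials. -/
def dirichletSubmodule (K : Set ℂ) : Submodule ℂ C(K, ℂ) where
  carrier := {g | ∃ D, IsDirichletPolynomial D ∧ ∀ z : K, g z = D z}
  zero_mem' := ⟨_, IsDirichletPolynomial.zero, fun _ => rfl⟩
  add_mem' := by
    rintro _ _ ⟨D, hD, h⟩ ⟨D', hD', h'⟩
    exact ⟨_, hD.add hD', fun z => by simp [h, h']⟩
  smul_mem' := by
    rintro c _ ⟨D, hD, h⟩
    exact ⟨_, hD.const_mul c, fun z => by simp [h]⟩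

lemma expOn_log_mem_dirichletSubmodule {K : Set ℂ} {k : ℕ} (hk : 1 ≤ k) :
    expOn K (Real.log k) ∈ dirichletSubmodule K := by
  refine ⟨_, IsDirichletPolynomial.natCast_cpow hk, fun z => ?_⟩
  have hk0 : (k : ℂ) ≠ 0 := by exact_mod_cast (by omega : k ≠ 0)
  rw [cpow_def_of_ne_zero hk0, ← natCast_log]
  rfl

lemma negOn_pow_mem_closure {K : Set ℂ} [CompactSpace K] (n : ℕ) :
    negOn K ^ n ∈ (dirichletSubmodule K).topologicalClosure := by
  have : IsClosed ((dirichletSubmodule K).topologicalClosure : Set C(K, ℂ)) :=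
    Submodule.isClosed_topologicalClosure _
  have h := clm_expOn_mul_pow_eq_zero (K := K)
    (T := (dirichletSubmodule K).topologicalClosure.mkQL)
    (fun k hk => (Submodule.Quotient.mk_eq_zero _).mpr
      (Submodule.le_topologicalClosure _ (expOn_log_mem_dirichletSubmodule hk))) n 0
  have h1 : expOn K 0 = 1 := by ext z; simp [expOn]
  rw [h1, one_mul] at h
  exact (Submodule.Quotient.mk_eq_zero _).mp h

/-- Polynomials are uniform limits of Dirichlet polynomials on compact sets. -/
lemma dirichletApprox_polynomial {K : Set ℂ} (hK : IsCompact K) (p : Polynomial ℂ) :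
    DirichletApprox K fun z => p.eval z := by
  have := isCompact_iff_compactSpace.mp hK
  have hmem : Polynomial.aeval (negOn K) (p.comp (-Polynomial.X)) ∈
      (dirichletSubmodule K).topologicalClosure := by
    rw [Polynomial.aeval_eq_sum_range]
    exact Submodule.sum_mem _ fun n _ => Submodule.smul_mem _ _ (negOn_pow_mem_closure n)
  intro ε hε
  obtain ⟨g, ⟨D, hD, hgD⟩, hg⟩ := Metric.mem_closure_iff.mp hmem ε hε
  refine ⟨D, hD, fun z hz => ?_⟩
  have h1 := ((Polynomial.aeval (negOn K) (p.comp (-Polynomial.X)) - g).norm_coe_le_norm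
    ⟨z, hz⟩).trans_lt (by rwa [← dist_eq_norm])
  have h2 : (Polynomial.aeval (negOn K) (p.comp (-Polynomial.X))) ⟨z, hz⟩ = p.eval z := by
    change ContinuousMap.evalAlgHom ℂ ℂ (⟨z, hz⟩ : K) _ = _
    rw [← Polynomial.aeval_algHom_apply]
    simp [negOn]
  rwa [ContinuousMap.sub_apply, h2, hgD] at h1

lemma PolyApprox.dirichletApprox {K : Set ℂ} (hK : IsCompact K) {f : ℂ → ℂ}
    (hf : PolyApprox K f) : DirichletApprox K f := by
  intro ε hε
  obtain ⟨p, hp⟩ := hf (ε / 2) (by positivity)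
  obtain ⟨D, hD, hpD⟩ := dirichletApprox_polynomial hK p (ε / 2) (by positivity)
  refine ⟨D, hD, fun z hz => ?_⟩
  calc ‖f z - D z‖ ≤ ‖f z - p.eval z‖ + ‖p.eval z - D z‖ := norm_sub_le_norm_sub_add_norm_sub ..
    _ < ε := by linarith [hp z hz, hpD z hz]

lemma isPreconnected_setOf_lt_norm (R : ℝ) : IsPreconnected {z : ℂ | R < ‖z‖} := by
  have : {z : ℂ | R < ‖z‖} =
      (fun q : ℝ × ℝ => (q.1 : ℂ) * exp (q.2 * I)) '' (Ioi R ×ˢ univ) := by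
    ext z
    constructor
    · exact fun hz => ⟨(‖z‖, arg z), ⟨hz, mem_univ _⟩, norm_mul_exp_arg_mul_I z⟩
    · rintro ⟨q, ⟨hq, -⟩, rfl⟩
      simpa [norm_exp_ofReal_mul_I] using hq.trans_le (le_abs_self _)
  rw [this]
  exact (isPreconnected_Ioi.prod isPreconnected_univ).image _ (by fun_prop)

lemma frontier_connectedComponentIn_compl_subset {K : Set ℂ} (hK : IsClosed K) (a : ℂ) :
    frontier (connectedComponentIn Kᶜ a) ⊆ K := by
  intro p hp
  by_contra hpK
  have hpU := hK.isOpen_compl.connectedComponentIn (x := p)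
  obtain ⟨q, hqp, hqa⟩ := mem_closure_iff.mp (frontier_subset_closure hp) _ hpU
    (mem_connectedComponentIn hpK)
  rw [(hK.isOpen_compl.connectedComponentIn).frontier_eq] at hp
  refine hp.2 ?_
  rw [connectedComponentIn_eq hqa, ← connectedComponentIn_eq hqp]
  exact mem_connectedComponentIn hpK

/-- If Dirichlet polynomials approximate `z ↦ (z - a)⁻¹` on `K`, then the component of `a` in
the complement of `K` is unbounded. -/
lemma not_isBounded_connectedComponentIn {K : Set ℂ} (hK : IsCompact K) {a : ℂ} (ha : a ∉ K)
    (h : DirichletApprox K fun z => (z - a)⁻¹) :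
    ¬ Bornology.IsBounded (connectedComponentIn Kᶜ a) := by
  intro hb
  obtain ⟨B, hB0, hB⟩ : ∃ B > 0, ∀ z ∈ K, ‖z - a‖ ≤ B := by
    obtain ⟨B, hB⟩ := hK.exists_bound_of_continuousOn (f := fun z => z - a) (by fun_prop)
    exact ⟨max B 1, by positivity, fun z hz => (hB z hz).trans (le_max_left _ _)⟩
  obtain ⟨D, hD, hDK⟩ := h (1 / (2 * B)) (by positivity)
  have hdiff : Differentiable ℂ fun z => 1 - (z - a) * D z :=
    ((differentiable_id.sub_const a).mul hD.differentiable).const_sub 1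
  have hle : ∀ z ∈ frontier (connectedComponentIn Kᶜ a), ‖1 - (z - a) * D z‖ ≤ 1 / 2 := by
    intro z hz
    have hzK := frontier_connectedComponentIn_compl_subset hK.isClosed a hz
    have hza : z - a ≠ 0 := sub_ne_zero.mpr fun e => ha (e ▸ hzK)
    have : 1 - (z - a) * D z = (z - a) * ((z - a)⁻¹ - D z) := by
      rw [mul_sub, mul_inv_cancel₀ hza]
    rw [this, norm_mul]
    calc ‖z - a‖ * ‖(z - a)⁻¹ - D z‖ ≤ B * (1 / (2 * B)) :=
          mul_le_mul (hB z hzK) (hDK z hzK).le (norm_nonneg _) hB0.le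
      _ = 1 / 2 := by field_simp
  have := Complex.norm_le_of_forall_mem_frontier_norm_le hb hdiff.diffContOnCl hle
    (subset_closure (mem_connectedComponentIn ha))
  norm_num at this

lemma isConnected_compl_of_not_isBounded {K : Set ℂ} (hK : IsCompact K)
    (h : ∀ a ∉ K, ¬ Bornology.IsBounded (connectedComponentIn Kᶜ a)) : IsConnected Kᶜ := by
  obtain ⟨R, hR0, hR⟩ : ∃ R ≥ 0, ∀ z ∈ K, ‖z‖ ≤ R := by
    obtain ⟨R, hR⟩ := hK.isBounded.exists_norm_le
    exact ⟨max R 0, le_max_right _ _, fun z hz => (hR z hz).trans (le_max_left _ _)⟩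
  set V : Set ℂ := {z | R < ‖z‖} with hV
  have hVK : V ⊆ Kᶜ := fun z hz hzK => (hR z hzK).not_gt hz
  have hw : ((R + 1 : ℝ) : ℂ) ∈ V := by
    rw [hV, mem_ofPred_eq, norm_real, Real.norm_of_nonneg (by positivity)]
    linarith
  refine ⟨⟨_, hVK hw⟩, ?_⟩
  set w : ℂ := ((R + 1 : ℝ) : ℂ)
  have hVw : V ⊆ connectedComponentIn Kᶜ w :=
    (isPreconnected_setOf_lt_norm R).subset_connectedComponentIn hw hVK
  have : Kᶜ = connectedComponentIn Kᶜ w := by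
    refine Subset.antisymm (fun a ha => ?_) (connectedComponentIn_subset _ _)
    obtain ⟨q, hqa, hqV⟩ : ∃ q ∈ connectedComponentIn Kᶜ a, q ∈ V := by
      by_contra! hcon
      refine h a ha ((Metric.isBounded_closedBall (x := 0) (r := R)).subset fun q hq => ?_)
      simpa [hV] using hcon q hq
    rw [connectedComponentIn_eq (hVw hqV), ← connectedComponentIn_eq hqa]
    exact mem_connectedComponentIn ha
  rw [this]
  exact isPreconnected_connectedComponentIn

/-- For a compact set `K ⊆ ℂ`, the complement of `K` is connected if and only if every
function continuous on `K` and holomorphic on the interior of `K` can be uniformly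
approximated on `K` by Dirichlet polynomials. -/
theorem dirichlet_mergelyan (K : Set ℂ) (hK : IsCompact K) :
    IsConnected Kᶜ ↔
      ∀ f : ℂ → ℂ, ContinuousOn f K → DifferentiableOn ℂ f (interior K) →
        ∀ ε > 0, ∃ D : ℂ → ℂ, IsDirichletPolynomial D ∧ ∀ z ∈ K, ‖f z - D z‖ < ε := by
  refine ⟨fun hconn f hf hd => ?_, fun h => ?_⟩
  · exact (polyApprox_of_isPreconnected_compl hK hconn.isPreconnected hf hd).dirichletApprox hK
  · refine isConnected_compl_of_not_isBounded hK fun a ha => ?_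
    have hne : ∀ z ∈ K, z - a ≠ 0 := fun z hz => sub_ne_zero.mpr fun e => ha (e ▸ hz)
    refine not_isBounded_connectedComponentIn hK ha (h _ ?_ ?_)
    · exact (continuousOn_id.sub continuousOn_const).inv₀ hne
    · exact (differentiableOn_id.sub_const a).inv fun z hz => hne z (interior_subset hz)
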